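/- (Theorem 1, half-space safe set) Let ε ∈ (0,1), α ∈ [0,1], f : ℝ^n → ℝ^n, g : ℝ^n → ℝ^{n×m}, and let Σ_w ∈ ℝ^{n×n} be symmetric positive definite. Let h(x) = qᵀ x + r with q ∈ ℝ^n and r ∈ ℝ, and fix x ∈ ℝ^n and u ∈ ℝ^m. Assume WCVaR_ε[w ↦ qᵀ w] (over 𝒫(Σ_w)) is finite. Then the risk-aware CBF constraint WCVaR_ε[w ↦ −h(f(x) + g(x)u + w)] ≤ −α h(x) holds if and only if −qᵀ g(x) u ≤ qᵀ( f(x) − α x ) + (1 − α) r − WCVaR_ε[w ↦ qᵀ w]. -/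

import Mathlib

open MeasureTheory Matrix

/-- Conditional value-at-risk of a loss at level ε with respect to P. -/
noncomputable def CVaR {n : ℕ} (ε : ℝ) (P : Measure (Fin n → ℝ)) (L : (Fin n → ℝ) → ℝ) : ℝ :=
  ⨅ β : ℝ, (β + (1 / ε) * ∫ w, max (L w - β) 0 ∂P)

/-- The set of Borel probability measures on ℝ^n with finite second moments,
zero mean, and second-moment matrix Σ. -/
def Pset (n : ℕ) (S : Matrix (Fin n) (Fin n) ℝ) : Set (Measure (Fin n → ℝ)) :=
  {P | IsProbabilityMeasure P ∧ Integrable (fun w => ‖w‖ ^ 2) P ∧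
    (∀ i, ∫ w, w i ∂P = 0) ∧ ∀ i j, ∫ w, w i * w j ∂P = S i j}

/-- Worst-case CVaR over the moment set, valued in the extended reals. -/
noncomputable def WCVaR {n : ℕ} (ε : ℝ) (S : Matrix (Fin n) (Fin n) ℝ)
    (L : (Fin n → ℝ) → ℝ) : EReal :=
  ⨆ P ∈ Pset n S, ((CVaR ε P L : ℝ) : EReal)

/-- The Rockafellar-Uryasev objective of an integrable loss is bounded below by its mean. -/
theorem bddBelow_CVaR_objective {n : ℕ} {ε : ℝ} (hε : ε ∈ Set.Ioo (0 : ℝ) 1)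
    {P : Measure (Fin n → ℝ)} [IsProbabilityMeasure P] {L : (Fin n → ℝ) → ℝ}
    (hL : Integrable L P) :
    BddBelow (Set.range fun β : ℝ => β + (1 / ε) * ∫ w, max (L w - β) 0 ∂P) := by
  refine ⟨∫ w, L w ∂P, ?_⟩
  rintro _ ⟨β, rfl⟩
  have hint : Integrable (fun w => L w - β) P := hL.sub (integrable_const β)
  have hpos : 0 ≤ ∫ w, max (L w - β) 0 ∂P := integral_nonneg fun w => le_max_right _ _
  have hmean : (∫ w, L w ∂P) - β ≤ ∫ w, max (L w - β) 0 ∂P := by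
    calc (∫ w, L w ∂P) - β = ∫ w, (L w - β) ∂P := by
          rw [integral_sub hL (integrable_const β)]; simp
      _ ≤ _ := integral_mono hint hint.pos_part fun w => le_max_left _ _
  have hle : 1 ≤ 1 / ε := by rw [le_div_iff₀ hε.1]; linarith [hε.2]
  have := le_mul_of_one_le_left hpos hle
  dsimp only
  linarith

/-- Translation equivariance of CVaR. -/
theorem CVaR_add_const {n : ℕ} {ε : ℝ} (hε : ε ∈ Set.Ioo (0 : ℝ) 1)
    {P : Measure (Fin n → ℝ)} [IsProbabilityMeasure P] {L : (Fin n → ℝ) → ℝ}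
    (hL : Integrable L P) (c : ℝ) :
    CVaR ε P (fun w => L w + c) = CVaR ε P L + c := by
  unfold CVaR
  rw [ciInf_add (bddBelow_CVaR_objective hε hL), ← (Equiv.addRight c).iInf_comp]
  refine iInf_congr fun β => ?_
  simp only [Equiv.coe_addRight, add_sub_add_right_eq_sub]
  ring

theorem integrable_dotProduct_of_mem_Pset {n : ℕ} {S : Matrix (Fin n) (Fin n) ℝ}
    {P : Measure (Fin n → ℝ)} (hP : P ∈ Pset n S) (q : Fin n → ℝ) :
    Integrable (fun w => q ⬝ᵥ w) P := by
  obtain ⟨_, h2, -, -⟩ := hP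
  refine integrable_finsetSum _ fun i _ => Integrable.const_mul ?_ (q i)
  refine ((integrable_const (1 : ℝ)).add h2).mono' (measurable_pi_apply i).aestronglyMeasurable
    (ae_of_all _ fun w => ?_)
  have := norm_le_pi_norm w i
  simp only [Pi.add_apply]
  nlinarith [sq_nonneg (‖w‖ - 1), norm_nonneg w]

/-- The moment set is invariant under reflection through the origin. -/
theorem map_neg_mem_Pset {n : ℕ} {S : Matrix (Fin n) (Fin n) ℝ}
    {P : Measure (Fin n → ℝ)} (hP : P ∈ Pset n S) :
    P.map (MeasurableEquiv.neg (Fin n → ℝ)) ∈ Pset n S := by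
  obtain ⟨_, h2, h1, hS⟩ := hP
  refine ⟨Measure.isProbabilityMeasure_map (MeasurableEquiv.measurable _).aemeasurable, ?_, ?_, ?_⟩
  · rw [integrable_map_equiv]
    simpa [Function.comp_def] using h2
  · intro i
    rw [integral_map_equiv]
    simp [integral_neg, h1]
  · intro i j
    rw [integral_map_equiv]
    simpa using hS i j

theorem CVaR_map_neg {n : ℕ} (ε : ℝ) (P : Measure (Fin n → ℝ)) (L : (Fin n → ℝ) → ℝ) :
    CVaR ε (P.map (MeasurableEquiv.neg (Fin n → ℝ))) L = CVaR ε P (fun w => L (-w)) := by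
  unfold CVaR
  refine iInf_congr fun β => ?_
  rw [integral_map_equiv]
  rfl

theorem WCVaR_le_coe_iff {n : ℕ} {ε : ℝ} {S : Matrix (Fin n) (Fin n) ℝ}
    {L : (Fin n → ℝ) → ℝ} {a : ℝ} :
    WCVaR ε S L ≤ (a : EReal) ↔ ∀ P ∈ Pset n S, CVaR ε P L ≤ a := by
  simp [WCVaR]

/-- The worst-case CVaR over a moment set does not change when the loss is reflected. -/
theorem WCVaR_comp_neg {n : ℕ} (ε : ℝ) (S : Matrix (Fin n) (Fin n) ℝ) (L : (Fin n → ℝ) → ℝ) :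
    WCVaR ε S (fun w => L (-w)) = WCVaR ε S L := by
  have key : ∀ L : (Fin n → ℝ) → ℝ, WCVaR ε S (fun w => L (-w)) ≤ WCVaR ε S L := fun L =>
    iSup₂_le fun P hP => by
      rw [← CVaR_map_neg]
      exact le_iSup₂ (f := fun (P : Measure (Fin n → ℝ)) (_ : P ∈ Pset n S) =>
        ((CVaR ε P L : ℝ) : EReal)) _ (map_neg_mem_Pset hP)
  refine le_antisymm (key L) ?_
  simpa using key fun w => L (-w)

/-- (Theorem 1, half-space safe set) For the affine barrier function
h(x) = qᵀx + r, the risk-aware CBF constraint holds iff the control input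
satisfies an explicit affine inequality. -/
theorem halfspace_cbf {n m : ℕ} (ε : ℝ) (hε : ε ∈ Set.Ioo (0 : ℝ) 1)
    (α : ℝ) (hα : α ∈ Set.Icc (0 : ℝ) 1)
    (f : (Fin n → ℝ) → (Fin n → ℝ)) (g : (Fin n → ℝ) → Matrix (Fin n) (Fin m) ℝ)
    (Sw : Matrix (Fin n) (Fin n) ℝ) (hSw : Sw.PosDef)
    (q : Fin n → ℝ) (r : ℝ) (x : Fin n → ℝ) (u : Fin m → ℝ)
    (cvw : ℝ) (hcvw : WCVaR ε Sw (fun w => q ⬝ᵥ w) = ((cvw : ℝ) : EReal)) :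
    (WCVaR ε Sw (fun w => -(q ⬝ᵥ (f x + (g x).mulVec u + w) + r)) ≤
        ((-(α * (q ⬝ᵥ x + r)) : ℝ) : EReal)) ↔
      -(q ⬝ᵥ (g x).mulVec u) ≤ q ⬝ᵥ (f x - α • x) + (1 - α) * r - cvw := by
  have hloss : (fun w => -(q ⬝ᵥ (f x + (g x).mulVec u + w) + r)) =
      fun w => q ⬝ᵥ (-w) + -(q ⬝ᵥ f x + q ⬝ᵥ (g x).mulVec u + r) := by
    funext w
    simp only [dotProduct_add, dotProduct_neg]
    ring
  have hshift : ∀ P ∈ Pset n Sw, CVaR ε P (fun w => -(q ⬝ᵥ (f x + (g x).mulVec u + w) + r)) =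
      CVaR ε P (fun w => q ⬝ᵥ (-w)) + -(q ⬝ᵥ f x + q ⬝ᵥ (g x).mulVec u + r) := by
    intro P hP
    have := hP.1
    rw [hloss, CVaR_add_const hε]
    simp only [dotProduct_neg]
    exact (integrable_dotProduct_of_mem_Pset hP q).neg
  calc _ ↔ ∀ P ∈ Pset n Sw, CVaR ε P (fun w => q ⬝ᵥ (-w)) ≤
        -(α * (q ⬝ᵥ x + r)) + (q ⬝ᵥ f x + q ⬝ᵥ (g x).mulVec u + r) := by
        rw [WCVaR_le_coe_iff]
        refine forall₂_congr fun P hP => ?_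
        rw [hshift P hP]
        constructor <;> intro h <;> linarith
    _ ↔ cvw ≤ -(α * (q ⬝ᵥ x + r)) + (q ⬝ᵥ f x + q ⬝ᵥ (g x).mulVec u + r) := by
        rw [← WCVaR_le_coe_iff, WCVaR_comp_neg ε Sw (fun w => q ⬝ᵥ w), hcvw, EReal.coe_le_coe_iff]
    _ ↔ _ := by
        simp only [dotProduct_sub, dotProduct_smul, smul_eq_mul]
        constructor <;> intro h <;> linarith
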